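/- arXiv:2512.03327 — 5 statements merged into one kernel-verified Lean document; each statement's English description precedes it below -/
import Mathlib

section
/- Let K be a number field, p a prime number, and x ∈ K^×. If for every maximal ideal v of 𝒪_K the element x is a p-th power in the v-adic completion K_v, then x is a p-th power in K. -/
open NumberField IsDedekindDomain

section Helpers

open Filter Topology Ideal

noncomputable def Zt (F : Type) [Field F] [NumberField F] (s : ℝ) : ℝ :=
  ∑' I : {I : Ideal (𝓞 F) // I ≠ ⊥}, (absNorm I.1 : ℝ) ^ (-s)

section
variable (F : Type) [Field F] [NumberField F]

theorem lseries_summable (s : ℝ) (hs : 1 < s) :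
    LSeriesSummable (fun n ↦ (Nat.card {I : Ideal (𝓞 F) // absNorm I = n} : ℂ)) s := by
  have h := LSeriesSummable_of_sum_norm_bigO_and_nonneg
    (f := fun n ↦ (Nat.card {I : Ideal (𝓞 F) // absNorm I = n} : ℝ)) (r := 1) ?_
    (fun _ ↦ Nat.cast_nonneg _) zero_le_one (s := s) (by simpa using hs)
  · simpa using h
  have h1 : Tendsto (fun n : ℕ ↦ (∑ k ∈ Finset.Icc 1 n,
      (Nat.card {I : Ideal (𝓞 F) // absNorm I = k} : ℝ)) / n) atTop
      (𝓝 (dedekindZeta_residue F)) := by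
    refine ((Ideal.tendsto_norm_le_div_atTop₀ F).comp tendsto_natCast_atTop_atTop).congr fun n ↦ ?_
    simp only [Function.comp_apply, Nat.cast_le, ← Nat.cast_sum]
    congr
    rw [← add_left_inj 1, ← card_norm_le_eq_card_norm_le_add_one,
      show Finset.Icc 1 n = Finset.Ioc 0 n from Finset.Icc_succ_left_eq_Ioc _ _,
      show 1 = Nat.card {I : Ideal (𝓞 F) // absNorm I = 0} by simp [Ideal.absNorm_eq_zero_iff],
      Finset.sum_Ioc_add_eq_sum_Icc (n.zero_le),
      ← Finset.card_preimage_eq_sum_card_image_eq (fun k _ ↦ finite_setOfPred_absNorm_eq k)]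
    simp [Set.coe_eq_subtype]
  have h2 := h1.isBigO_one ℝ
  have h3 := h2.mul (Asymptotics.isBigO_refl (fun n : ℕ ↦ (n : ℝ)) atTop)
  refine (h3.congr' ?_ ?_)
  · filter_upwards [eventually_gt_atTop 0] with n hn
    have : (n : ℝ) ≠ 0 := by positivity
    field_simp
  · filter_upwards with n
    simp

theorem zt_hasSum (s : ℝ) (hs : 1 < s) :
    Summable (fun I : {I : Ideal (𝓞 F) // I ≠ ⊥} ↦ (absNorm I.1 : ℝ) ^ (-s)) ∧
    (Zt F s : ℂ) = dedekindZeta F s := by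
  set a : ℕ → ℕ := fun n ↦ Nat.card {I : Ideal (𝓞 F) // absNorm I = n} with ha
  let g : Ideal (𝓞 F) → ℝ := fun I ↦ (absNorm I : ℝ) ^ (-s)
  have hfib : ∀ n, Finite {I : Ideal (𝓞 F) // absNorm I = n} := fun n ↦
    (finite_setOfPred_absNorm_eq n)
  have hterm : ∀ n, LSeries.term (fun n ↦ (a n : ℂ)) s n = ((a n * (n : ℝ) ^ (-s) : ℝ) : ℂ) := by
    intro n
    rcases eq_or_ne n 0 with rfl | hn
    · simp [Real.zero_rpow (show -s ≠ 0 by linarith)]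
    · rw [LSeries.term_of_ne_zero hn, Real.rpow_neg (by positivity)]
      push_cast
      rw [Complex.ofReal_cpow (by positivity)]
      simp [div_eq_mul_inv]
  have hsum : Summable (fun n ↦ a n * (n : ℝ) ^ (-s)) := by
    have := lseries_summable F s hs
    rw [LSeriesSummable] at this
    rw [← Complex.summable_ofReal]
    refine this.congr hterm
  let e := Equiv.sigmaFiberEquiv (fun I : Ideal (𝓞 F) ↦ absNorm I)
  have hfs : ∀ n, ∑' I : {I : Ideal (𝓞 F) // absNorm I = n}, g I = a n * (n : ℝ) ^ (-s) := by
    intro n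
    have : ∀ I : {I : Ideal (𝓞 F) // absNorm I = n}, g I = (n : ℝ) ^ (-s) := by
      rintro ⟨I, rfl⟩; rfl
    simp only [this, tsum_const, nsmul_eq_mul, ha]
  have hsig : Summable (g ∘ e) := by
    rw [summable_sigma_of_nonneg (fun x ↦ by simp only [g, Function.comp]; positivity)]
    refine ⟨fun n ↦ Summable.of_finite, ?_⟩
    refine hsum.congr fun n ↦ (hfs n).symm
  have hg : Summable g := e.summable_iff.mp hsig
  have hsupp : Function.support g ⊆ {I | I ≠ ⊥} := by
    intro I hI h
    apply hI
    subst h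
    simp [g, Real.zero_rpow (show -s ≠ 0 by linarith)]
  refine ⟨hg.subtype _, ?_⟩
  have h1 : Zt F s = ∑' I, g I := tsum_subtype_eq_of_support_subset hsupp
  have h2 : ∑' I, g I = ∑' n, (a n * (n : ℝ) ^ (-s)) := by
    rw [← e.tsum_eq]
    refine (Summable.tsum_sigma' (fun n ↦ Summable.of_finite) hsig).trans ?_
    exact tsum_congr hfs
  rw [h1, h2, dedekindZeta, LSeries, Complex.ofReal_tsum]
  exact tsum_congr fun n ↦ (hterm n).symm

theorem zt_tendsto : Tendsto (fun s ↦ (s - 1) * Zt F s) (𝓝[>] 1) (𝓝 (dedekindZeta_residue F)) := by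
  have h := tendsto_sub_one_mul_dedekindZeta_nhdsGT F
  have h' := (Complex.continuous_re.tendsto _).comp h
  simp only [Complex.ofReal_re] at h'
  refine h'.congr' ?_
  filter_upwards [self_mem_nhdsWithin] with s hs
  simp only [Function.comp]
  rw [← (zt_hasSum F s hs).2]
  norm_cast

variable {F}

theorem norm_ge_two {P : Ideal (𝓞 F)} (h0 : P ≠ ⊥) (hP : P.IsPrime) : 2 ≤ absNorm P := by
  have h1 : absNorm P ≠ 0 := by rwa [Ne, absNorm_eq_zero_iff]
  have h2 : absNorm P ≠ 1 := by rw [Ne, absNorm_eq_one_iff]; exact hP.ne_top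
  omega

theorem zt_lower (s : ℝ) (hs : 1 < s) (T : Finset (Ideal (𝓞 F)))
    (hT : ∀ P ∈ T, P ≠ ⊥ ∧ P.IsPrime) :
    ∏ P ∈ T, (1 + (absNorm P : ℝ) ^ (-s)) ≤ Zt F s := by
  classical
  rw [Finset.prod_one_add]
  have hne : ∀ U ∈ T.powerset, U.prod id ≠ ⊥ := by
    intro U hU
    rw [← Ideal.zero_eq_bot, Finset.prod_ne_zero_iff]
    intro P hP
    exact (hT P (Finset.mem_powerset.mp hU hP)).1
  have hprime : ∀ P ∈ T, Prime P := fun P hP ↦ Ideal.prime_of_isPrime (hT P hP).1 (hT P hP).2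
  have hnf : ∀ U ∈ T.powerset, UniqueFactorizationMonoid.normalizedFactors (U.prod id) = U.val := by
    intro U hU
    have := UniqueFactorizationMonoid.normalizedFactors_prod_of_prime (m := U.val)
      (fun P hP ↦ hprime P (Finset.mem_powerset.mp hU hP))
    rw [← this, Finset.prod, Multiset.map_id]
  let i : T.powerset → {I : Ideal (𝓞 F) // I ≠ ⊥} := fun U ↦ ⟨U.1.prod id, hne U.1 U.2⟩
  have hi : Function.Injective i := by
    intro U V h
    have h' : U.1.prod id = V.1.prod id := congrArg Subtype.val h
    apply Subtype.ext
    apply Finset.val_injective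
    rw [← hnf U.1 U.2, ← hnf V.1 V.2, h']
  have hZ := (zt_hasSum F s hs).1
  have h3 := hZ.sum_le_tsum (Finset.univ.map ⟨i, hi⟩) (fun I _ ↦ by positivity)
  rw [Finset.sum_map] at h3
  refine le_trans (le_of_eq ?_) h3
  rw [← Finset.sum_coe_sort]
  refine Finset.sum_congr rfl fun U _ ↦ ?_
  simp only [Function.Embedding.coeFn_mk, i, map_prod, id]
  push_cast
  rw [Real.finsetProd_rpow _ _ (fun _ _ ↦ by positivity)]

theorem zt_upper (s : ℝ) (hs : 1 < s) (C : ℝ)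
    (hC : ∀ T : Finset (Ideal (𝓞 F)), (∀ P ∈ T, P ≠ ⊥ ∧ P.IsPrime) →
      ∏ P ∈ T, (1 - (absNorm P : ℝ) ^ (-s))⁻¹ ≤ C) : Zt F s ≤ C := by
  classical
  refine (zt_hasSum F s hs).1.tsum_le_of_sum_le fun S ↦ ?_
  let nf : Ideal (𝓞 F) → Multiset (Ideal (𝓞 F)) := UniqueFactorizationMonoid.normalizedFactors
  let T : Finset (Ideal (𝓞 F)) := S.biUnion fun I ↦ (nf I.1).toFinset
  have hT : ∀ P ∈ T, P ≠ ⊥ ∧ P.IsPrime := by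
    intro P hP
    simp only [T, Finset.mem_biUnion, Multiset.mem_toFinset] at hP
    obtain ⟨I, -, hP⟩ := hP
    have := UniqueFactorizationMonoid.prime_of_normalized_factor P hP
    exact ⟨this.ne_zero, Ideal.isPrime_of_prime this⟩
  refine le_trans ?_ (hC T hT)
  let n : ℕ := S.sup fun I ↦ (nf I.1).card
  let φ : {I : Ideal (𝓞 F) // I ≠ ⊥} → (T → ℕ) := fun I P ↦ (nf I.1).count P.1
  have hsub : ∀ I ∈ S, (nf I.1).toFinset ⊆ T := fun I hI ↦
    Finset.subset_biUnion_of_mem (fun I : {I : Ideal (𝓞 F) // I ≠ ⊥} ↦ (nf I.1).toFinset) hI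
  have hprod : ∀ I : {I : Ideal (𝓞 F) // I ≠ ⊥}, (nf I.1).prod = I.1 := fun I ↦
    Ideal.prod_normalizedFactors_eq_self I.2
  have hval : ∀ I ∈ S, (absNorm I.1 : ℝ) ^ (-s) = ∏ P : T, ((absNorm P.1 : ℝ) ^ (-s)) ^ (φ I P) := by
    intro I hI
    conv_lhs => rw [← hprod I]
    rw [Finset.prod_coe_sort T (fun P ↦ ((absNorm P : ℝ) ^ (-s)) ^ ((nf I.1).count P)),
      Finset.prod_multiset_count_of_subset _ _ (hsub I hI), map_prod]
    push_cast
    rw [← Real.finsetProd_rpow _ _ (fun _ _ ↦ by positivity)]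
    refine Finset.prod_congr rfl fun P _ ↦ ?_
    rw [map_pow]
    push_cast
    rw [Real.rpow_pow_comm (by positivity)]
  have hinj : Set.InjOn φ S := by
    intro I hI J hJ h
    apply Subtype.ext
    rw [← hprod I, ← hprod J]
    congr 1
    ext P
    by_cases hP : P ∈ T
    · exact congrFun h ⟨P, hP⟩
    · rw [Multiset.count_eq_zero_of_notMem, Multiset.count_eq_zero_of_notMem]
      · exact fun h ↦ hP (hsub J hJ (Multiset.mem_toFinset.mpr h))
      · exact fun h ↦ hP (hsub I hI (Multiset.mem_toFinset.mpr h))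
  rw [Finset.sum_congr rfl hval, ← Finset.sum_image (f := fun x : T → ℕ ↦
    ∏ P : T, ((absNorm P.1 : ℝ) ^ (-s)) ^ (x P)) hinj]
  have hsub2 : S.image φ ⊆ Fintype.piFinset (fun _ : T ↦ Finset.range (n + 1)) := by
    intro x hx
    obtain ⟨I, hI, rfl⟩ := Finset.mem_image.mp hx
    rw [Fintype.mem_piFinset]
    intro P
    rw [Finset.mem_range, Nat.lt_succ_iff]
    exact (Multiset.count_le_card _ _).trans
      (Finset.le_sup (f := fun I : {I : Ideal (𝓞 F) // I ≠ ⊥} ↦ (nf I.1).card) hI)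
  refine (Finset.sum_le_sum_of_subset_of_nonneg hsub2 (fun _ _ _ ↦ by positivity)).trans ?_
  rw [← Finset.prod_univ_sum, ← Finset.prod_coe_sort T (fun P ↦ (1 - (absNorm P : ℝ) ^ (-s))⁻¹)]
  refine Finset.prod_le_prod (fun _ _ ↦ Finset.sum_nonneg fun _ _ ↦ by positivity) fun P _ ↦ ?_
  have h2 := norm_ge_two (hT P.1 P.2).1 (hT P.1 P.2).2
  have hlt : (absNorm P.1 : ℝ) ^ (-s) < 1 :=
    Real.rpow_lt_one_of_one_lt_of_neg (by exact_mod_cast h2) (by linarith)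
  rw [← tsum_geometric_of_lt_one (by positivity) hlt]
  exact (summable_geometric_of_lt_one (by positivity) hlt).sum_le_tsum _ (fun _ _ ↦ by positivity)
end

theorem no_split (K E : Type) [Field K] [NumberField K] [Field E] [NumberField E] [Algebra K E]
    (B : Finset (Ideal (𝓞 K))) (w₁ w₂ : Ideal (𝓞 K) → Ideal (𝓞 E))
    (h : ∀ P : Ideal (𝓞 K), P ∉ B → P ≠ ⊥ → P.IsPrime →
      (w₁ P).IsPrime ∧ (w₂ P).IsPrime ∧ w₁ P ≠ w₂ P ∧
      (w₁ P).comap (algebraMap (𝓞 K) (𝓞 E)) = P ∧ (w₂ P).comap (algebraMap (𝓞 K) (𝓞 E)) = P ∧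
      absNorm (w₁ P) = absNorm P ∧ absNorm (w₂ P) = absNorm P) : False := by
  classical
  set C : ℝ := 2 ^ B.card * Real.exp (2 * Zt K 2) with hCdef
  have hCpos : 0 < C := by positivity
  have key : ∀ s : ℝ, 1 < s → Zt K s ≤ C * Real.sqrt (Zt E s) := by
    intro s hs
    refine zt_upper s hs _ fun T hT ↦ ?_
    let x : Ideal (𝓞 K) → ℝ := fun P ↦ (absNorm P : ℝ) ^ (-s)
    have hx0 : ∀ P, 0 ≤ x P := fun P ↦ by positivity
    have hx : ∀ P ∈ T, x P ≤ 1 / 2 ∧ x P ^ 2 ≤ (absNorm P : ℝ) ^ (-2 : ℝ) := by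
      intro P hP
      have h2 : (2 : ℝ) ≤ absNorm P := by exact_mod_cast norm_ge_two (hT P hP).1 (hT P hP).2
      have h3 : x P ≤ (absNorm P : ℝ) ^ (-1 : ℝ) :=
        Real.rpow_le_rpow_of_exponent_le (by linarith) (by linarith)
      constructor
      · refine h3.trans ?_
        rw [Real.rpow_neg_one, one_div]
        exact inv_anti₀ (by norm_num) h2
      · refine (pow_le_pow_left₀ (hx0 P) h3 2).trans (le_of_eq ?_)
        rw [← Real.rpow_natCast, ← Real.rpow_mul (by positivity)]
        norm_num
    have hbound : ∀ P ∈ T, (1 - x P)⁻¹ ≤ (if P ∈ B then 2 else 1) *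
        Real.exp (2 * (absNorm P : ℝ) ^ (-2 : ℝ)) * (if P ∉ B then 1 + x P else 1) := by
      intro P hP
      obtain ⟨h1, h2⟩ := hx P hP
      have h0 := hx0 P
      have he : 1 + 2 * x P ^ 2 ≤ Real.exp (2 * (absNorm P : ℝ) ^ (-2 : ℝ)) := by
        have := Real.add_one_le_exp (2 * (absNorm P : ℝ) ^ (-2 : ℝ))
        linarith
      by_cases hB : P ∈ B
      · simp only [hB, if_true, not_true_eq_false, if_false, mul_one]
        have : (1 - x P)⁻¹ ≤ 2 := by
          rw [inv_le_comm₀ (by linarith) (by norm_num)]; linarith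
        nlinarith [sq_nonneg (x P)]
      · simp only [hB, if_false, not_false_eq_true, if_true, one_mul]
        refine le_trans ?_ (mul_le_mul_of_nonneg_right he (by linarith))
        rw [inv_le_iff_one_le_mul₀ (by linarith)]
        have : x P ^ 2 ≤ 1 / 4 := by nlinarith
        nlinarith [sq_nonneg (x P)]
    refine (Finset.prod_le_prod (fun P hP ↦ ?_) hbound).trans ?_
    · have := (hx P hP).1
      exact inv_nonneg.mpr (by change 0 ≤ 1 - x P; linarith)
    rw [Finset.prod_mul_distrib, Finset.prod_mul_distrib]
    have hb1 : ∏ P ∈ T, (if P ∈ B then (2 : ℝ) else 1) ≤ 2 ^ B.card := by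
      rw [← Finset.prod_filter, Finset.prod_const]
      refine pow_le_pow_right₀ (by norm_num) (Finset.card_le_card ?_)
      intro P hP
      exact (Finset.mem_filter.mp hP).2
    have hb2 : ∏ P ∈ T, Real.exp (2 * (absNorm P : ℝ) ^ (-2 : ℝ)) ≤ Real.exp (2 * Zt K 2) := by
      rw [← Real.exp_sum, ← Finset.mul_sum]
      apply Real.exp_le_exp.mpr
      refine mul_le_mul_of_nonneg_left ?_ (by norm_num)
      let i : T → {I : Ideal (𝓞 K) // I ≠ ⊥} := fun P ↦ ⟨P.1, (hT P.1 P.2).1⟩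
      have hi : Function.Injective i := by
        intro P Q hPQ
        have h' : (i P).1 = (i Q).1 := by rw [hPQ]
        exact Subtype.ext h'
      have h3 := (zt_hasSum K 2 (by norm_num)).1.sum_le_tsum (Finset.univ.map ⟨i, hi⟩)
        (fun I _ ↦ by positivity)
      rw [Finset.sum_map] at h3
      rw [← Finset.sum_coe_sort]
      exact h3
    have hb3 : ∏ P ∈ T, (if P ∉ B then 1 + x P else 1) ≤ Real.sqrt (Zt E s) := by
      rw [← Finset.prod_filter]
      apply Real.le_sqrt_of_sq_le
      set G := T.filter (fun P ↦ P ∉ B) with hG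
      have hg : ∀ P ∈ G, _ := fun P hP ↦ h P (Finset.mem_filter.mp hP).2
        (hT P (Finset.mem_filter.mp hP).1).1 (hT P (Finset.mem_filter.mp hP).1).2
      have hg0 : ∀ P ∈ G, P ≠ ⊥ := fun P hP ↦ (hT P (Finset.mem_filter.mp hP).1).1
      have hinj1 : Set.InjOn w₁ G := by
        intro P hP Q hQ hPQ
        rw [← (hg P hP).2.2.2.1, hPQ, (hg Q hQ).2.2.2.1]
      have hinj2 : Set.InjOn w₂ G := by
        intro P hP Q hQ hPQ
        rw [← (hg P hP).2.2.2.2.1, hPQ, (hg Q hQ).2.2.2.2.1]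
      have hdisj : Disjoint (G.image w₁) (G.image w₂) := by
        rw [Finset.disjoint_left]
        intro I h1 h2
        obtain ⟨P, hP, rfl⟩ := Finset.mem_image.mp h1
        obtain ⟨Q, hQ, hPQ⟩ := Finset.mem_image.mp h2
        have : P = Q := by
          rw [← (hg P hP).2.2.2.1, ← hPQ, (hg Q hQ).2.2.2.2.1]
        subst this
        exact (hg P hP).2.2.1 hPQ.symm
      have hne : ∀ (P : Ideal (𝓞 K)) (I : Ideal (𝓞 E)), P ≠ ⊥ → absNorm I = absNorm P → I ≠ ⊥ := by
        intro P I hP hI h0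
        rw [h0, absNorm_bot, eq_comm, absNorm_eq_zero_iff] at hI
        exact hP hI
      have hl := zt_lower (F := E) s hs (G.image w₁ ∪ G.image w₂) (by
        intro I hI
        rcases Finset.mem_union.mp hI with hI | hI
        · obtain ⟨P, hP, rfl⟩ := Finset.mem_image.mp hI
          exact ⟨hne P _ (hg0 P hP) (hg P hP).2.2.2.2.2.1, (hg P hP).1⟩
        · obtain ⟨P, hP, rfl⟩ := Finset.mem_image.mp hI
          exact ⟨hne P _ (hg0 P hP) (hg P hP).2.2.2.2.2.2, (hg P hP).2.1⟩)
      rw [Finset.prod_union hdisj, Finset.prod_image hinj1, Finset.prod_image hinj2] at hl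
      refine le_trans (le_of_eq ?_) hl
      rw [sq]
      congr 1
      · exact Finset.prod_congr rfl fun P hP ↦ by rw [(hg P hP).2.2.2.2.2.1]
      · exact Finset.prod_congr rfl fun P hP ↦ by rw [(hg P hP).2.2.2.2.2.2]
    have hb3' : 0 ≤ ∏ P ∈ T, (if P ∉ B then 1 + x P else 1) :=
      Finset.prod_nonneg fun P _ ↦ by have := hx0 P; split_ifs <;> linarith
    rw [hCdef]
    gcongr
  have hK := (zt_tendsto K).pow 2
  have hE := ((zt_tendsto E).mul (f := fun s : ℝ ↦ (s - 1) * Zt E s)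
    (g := fun s : ℝ ↦ C ^ 2 * (s - 1)) (b := 0) (by
      have : Tendsto (fun s : ℝ ↦ C ^ 2 * (s - 1)) (𝓝 1) (𝓝 (C ^ 2 * (1 - 1))) := by
        apply Continuous.tendsto; fun_prop
      simpa using this.mono_left nhdsWithin_le_nhds))
  rw [mul_zero] at hE
  have hle : dedekindZeta_residue K ^ 2 ≤ 0 := by
    refine le_of_tendsto_of_tendsto hK hE ?_
    filter_upwards [self_mem_nhdsWithin] with s hs
    have hs' : (1 : ℝ) < s := hs
    have hZE : 0 ≤ Zt E s := tsum_nonneg fun _ ↦ by positivity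
    have hZK : 0 ≤ Zt K s := tsum_nonneg fun _ ↦ by positivity
    have := pow_le_pow_left₀ hZK (key s hs) 2
    rw [mul_pow, Real.sq_sqrt hZE] at this
    have h4 := mul_le_mul_of_nonneg_left this (sq_nonneg (s - 1))
    nlinarith
  have := pow_pos (dedekindZeta_residue_pos K) 2
  linarith

theorem exists_conductor (K E : Type) [Field K] [NumberField K] [Field E] [NumberField E]
    [Algebra K E] (α : 𝓞 E) (hα : Algebra.adjoin K {(α : E)} = ⊤) :
    ∃ d : 𝓞 K, d ≠ 0 ∧ ∀ z : 𝓞 E, d • z ∈ Algebra.adjoin (𝓞 K) {α} := by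
  classical
  have h1 : ∀ z : 𝓞 E, ∃ d : 𝓞 K, d ≠ 0 ∧ d • z ∈ Algebra.adjoin (𝓞 K) {α} := by
    intro z
    have hz : (z : E) ∈ Algebra.adjoin K {(α : E)} := by rw [hα]; trivial
    rw [Algebra.adjoin_singleton_eq_range_aeval] at hz
    obtain ⟨f, hf⟩ := hz
    obtain ⟨b, hb, hbf⟩ := IsLocalization.integerNormalization_spec (nonZeroDivisors (𝓞 K)) f
    refine ⟨b, nonZeroDivisors.ne_zero hb, ?_⟩
    rw [Algebra.adjoin_singleton_eq_range_aeval]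
    refine ⟨IsLocalization.integerNormalization (nonZeroDivisors (𝓞 K)) f, ?_⟩
    apply RingOfIntegers.coe_injective
    have h2 : Polynomial.aeval (α : E) ((IsLocalization.integerNormalization
        (nonZeroDivisors (𝓞 K)) f).map (algebraMap (𝓞 K) K)) = b • (z : E) := by
      have hbf2 : (IsLocalization.integerNormalization (nonZeroDivisors (𝓞 K)) f).map
          (algebraMap (𝓞 K) K) = Polynomial.C (algebraMap (𝓞 K) K b) * f := by
        refine hbf.trans ?_
        ext n
        rw [Polynomial.coeff_C_mul]
        change b • f.coeff n = _
        rw [Algebra.smul_def]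
      have hf2 : Polynomial.aeval (α : E) f = (z : E) := hf
      rw [hbf2, map_mul, Polynomial.aeval_C, hf2, Algebra.smul_def]
      rfl
    rw [Polynomial.aeval_map_algebraMap] at h2
    have h3 := Polynomial.aeval_algebraMap_apply E α
      (IsLocalization.integerNormalization (nonZeroDivisors (𝓞 K)) f)
    refine (h3.symm.trans h2).trans ?_
    rw [Algebra.smul_def, Algebra.smul_def, map_mul]
    rfl
  choose d hd0 hd using h1
  obtain ⟨S, hS⟩ := (Module.Finite.fg_top : (⊤ : Submodule (𝓞 K) (𝓞 E)).FG)
  refine ⟨∏ z ∈ S, d z, Finset.prod_ne_zero_iff.mpr fun z _ ↦ hd0 z, fun z ↦ ?_⟩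
  have hz : z ∈ Submodule.span (𝓞 K) (S : Set (𝓞 E)) := by rw [hS]; trivial
  induction hz using Submodule.span_induction with
  | mem x hx =>
    rw [← Finset.prod_erase_mul S d hx, mul_smul]
    exact Subalgebra.smul_mem _ (hd x) _
  | zero => rw [smul_zero]; exact Subalgebra.zero_mem _
  | add x y _ _ hx hy => rw [smul_add]; exact Subalgebra.add_mem _ hx hy
  | smul a x _ hx => rw [smul_comm]; exact Subalgebra.smul_mem _ hx _

theorem absNorm_eq_of (K E : Type) [Field K] [NumberField K] [Field E] [NumberField E]
    [Algebra K E] (α : 𝓞 E) (d : 𝓞 K) (hd : ∀ z : 𝓞 E, d • z ∈ Algebra.adjoin (𝓞 K) {α})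
    (P : Ideal (𝓞 K)) (hP : P.IsMaximal) (hdP : d ∉ P) (w : Ideal (𝓞 E))
    (hw : w.comap (algebraMap (𝓞 K) (𝓞 E)) = P) (c : 𝓞 K)
    (hc : α - algebraMap (𝓞 K) (𝓞 E) c ∈ w) : absNorm w = absNorm P := by
  let φ : 𝓞 K →+* 𝓞 E ⧸ w := (Ideal.Quotient.mk w).comp (algebraMap (𝓞 K) (𝓞 E))
  have hker : RingHom.ker φ = P := by
    rw [← hw, ← RingHom.comap_ker, Ideal.mk_ker]
  have hadj : ∀ y ∈ Algebra.adjoin (𝓞 K) {α}, ∃ r, φ r = Ideal.Quotient.mk w y := by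
    intro y hy
    induction hy using Algebra.adjoin_induction with
    | mem x hx =>
      rw [Set.mem_singleton_iff.mp hx]
      exact ⟨c, (Ideal.Quotient.eq.mpr hc).symm⟩
    | algebraMap r => exact ⟨r, rfl⟩
    | add x y _ _ hx hy =>
      obtain ⟨r, hr⟩ := hx
      obtain ⟨s, hs⟩ := hy
      exact ⟨r + s, by rw [map_add, map_add, hr, hs]⟩
    | mul x y _ _ hx hy =>
      obtain ⟨r, hr⟩ := hx
      obtain ⟨s, hs⟩ := hy
      exact ⟨r * s, by rw [map_mul, map_mul, hr, hs]⟩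
  have hsurj : Function.Surjective φ := by
    intro q
    obtain ⟨z, rfl⟩ := Ideal.Quotient.mk_surjective q
    obtain ⟨r, hr⟩ := hadj _ (hd z)
    obtain ⟨e, he⟩ := hP.exists_inv hdP
    obtain ⟨i, hi, hei⟩ := he
    have h1 : φ e * φ d = 1 := by
      rw [← map_mul, ← map_one φ, ← sub_eq_zero, ← map_sub, ← RingHom.mem_ker, hker]
      have : e * d - 1 = -i := by rw [← hei]; ring
      rw [this]; exact P.neg_mem hi
    refine ⟨e * r, ?_⟩
    rw [map_mul, hr, Algebra.smul_def, map_mul]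
    change φ e * (φ d * _) = _
    rw [← mul_assoc, h1, one_mul]
  have e := RingHom.quotientKerEquivOfSurjective hsurj
  rw [Ideal.absNorm_apply, Ideal.absNorm_apply, Submodule.cardQuot_apply, Submodule.cardQuot_apply,
    ← hker]
  exact (Nat.card_congr e.toEquiv).symm

theorem kummer_no (K E : Type) [Field K] [NumberField K] [Field E] [NumberField E]
    [Algebra K E] (p : ℕ) (hp : p.Prime) (ζ : 𝓞 K) (hζ : IsPrimitiveRoot ζ p) (a : 𝓞 K)
    (ha0 : a ≠ 0) (hmod : ∀ P : Ideal (𝓞 K), P ≠ ⊥ → P.IsPrime → ∃ b, b ^ p - a ∈ P)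
    (α : 𝓞 E) (hαp : α ^ p = algebraMap (𝓞 K) (𝓞 E) a) (hα : Algebra.adjoin K {(α : E)} = ⊤)
    (σ : 𝓞 E →ₐ[𝓞 K] 𝓞 E) (hσ : σ α = algebraMap (𝓞 K) (𝓞 E) ζ * α) : False := by
  classical
  obtain ⟨d, hd0, hd⟩ := exists_conductor K E α hα
  have : NeZero p := ⟨hp.ne_zero⟩
  have hζ1 : ζ - 1 ≠ 0 := sub_ne_zero.mpr (hζ.ne_one hp.one_lt)
  let m : 𝓞 K := d * a * (ζ - 1)
  have hm : m ≠ 0 := mul_ne_zero (mul_ne_zero hd0 ha0) hζ1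
  let B : Finset (Ideal (𝓞 K)) :=
    (UniqueFactorizationMonoid.normalizedFactors (Ideal.span {m})).toFinset
  have hB : ∀ P : Ideal (𝓞 K), P.IsPrime → P ∉ B → m ∉ P := by
    intro P hP hPB hmP
    apply hPB
    rw [Multiset.mem_toFinset, Ideal.mem_normalizedFactors_iff (by simpa using hm)]
    exact ⟨hP, by rwa [Ideal.span_singleton_le_iff_mem]⟩
  have hinj : Function.Injective (algebraMap (𝓞 K) (𝓞 E)) := FaithfulSMul.algebraMap_injective _ _
  have hζ' : IsPrimitiveRoot (algebraMap (𝓞 K) (𝓞 E) ζ) p := hζ.map_of_injective hinj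
  have hc : ∀ P : Ideal (𝓞 K), P ≠ ⊥ → P.IsPrime → ∀ w : Ideal (𝓞 E), w.IsPrime →
      w.comap (algebraMap (𝓞 K) (𝓞 E)) = P → ∃ c, α - algebraMap (𝓞 K) (𝓞 E) c ∈ w := by
    intro P hP0 hP w hw hwP
    obtain ⟨b, hb⟩ := hmod P hP0 hP
    have h1 : α ^ p - (algebraMap (𝓞 K) (𝓞 E) b) ^ p ∈ w := by
      rw [← hwP, Ideal.mem_comap] at hb
      rw [hαp, ← map_pow, ← neg_sub, ← map_sub]
      exact w.neg_mem hb
    rw [hζ'.pow_sub_pow_eq_prod_sub_mul α _ hp.pos] at h1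
    obtain ⟨η, hη, h2⟩ := (hw.prod_mem_iff).mp h1
    rw [Polynomial.mem_nthRootsFinset hp.pos] at hη
    obtain ⟨i, -, rfl⟩ := hζ'.eq_pow_of_pow_eq_one hη
    exact ⟨ζ ^ i * b, by rw [map_mul, map_pow]; exact h2⟩
  have hex : ∀ P : Ideal (𝓞 K), ∃ w : Ideal (𝓞 E), P ≠ ⊥ → P.IsPrime →
      (w.IsPrime ∧ w.comap (algebraMap (𝓞 K) (𝓞 E)) = P) := by
    intro P
    by_cases h : P ≠ ⊥ ∧ P.IsPrime
    · have := h.2.isMaximal h.1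
      obtain ⟨Q, hQ, hQP⟩ := Ideal.exists_ideal_over_maximal_of_isIntegral (S := 𝓞 E) P (by
        rw [(RingHom.injective_iff_ker_eq_bot _).mp hinj]; exact bot_le)
      exact ⟨Q, fun _ _ ↦ ⟨hQ.isPrime, hQP⟩⟩
    · exact ⟨⊤, fun h1 h2 ↦ (h ⟨h1, h2⟩).elim⟩
  choose w hw using hex
  refine no_split K E B w (fun P ↦ (w P).comap σ) fun P hPB hP0 hP ↦ ?_
  obtain ⟨hwp, hwP⟩ := hw P hP0 hP
  have hmP := hB P hP hPB
  have hdP : d ∉ P := fun h ↦ hmP (P.mul_mem_right _ (P.mul_mem_right _ h))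
  have haP : a ∉ P := fun h ↦ hmP (P.mul_mem_right _ (P.mul_mem_left _ h))
  have hζP : ζ - 1 ∉ P := fun h ↦ hmP (P.mul_mem_left _ h)
  have hw2p : ((w P).comap σ).IsPrime := Ideal.IsPrime.comap σ
  have hw2P : ((w P).comap σ).comap (algebraMap (𝓞 K) (𝓞 E)) = P := by
    conv_rhs => rw [← hwP]
    ext y
    simp only [Ideal.mem_comap, AlgHom.commutes]
  have hmax := hP.isMaximal hP0
  obtain ⟨c, hc1⟩ := hc P hP0 hP _ hwp hwP
  obtain ⟨c2, hc2⟩ := hc P hP0 hP _ hw2p hw2P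
  refine ⟨hwp, hw2p, ?_, hwP, hw2P, absNorm_eq_of K E α d hd P hmax hdP _ hwP c hc1,
    absNorm_eq_of K E α d hd P hmax hdP _ hw2P c2 hc2⟩
  intro heq
  have h1 : α - algebraMap (𝓞 K) (𝓞 E) c ∈ (w P).comap σ := heq ▸ hc1
  rw [Ideal.mem_comap, map_sub, hσ, AlgHom.commutes] at h1
  have h2 := (w P).sub_mem h1 hc1
  have h3 : algebraMap (𝓞 K) (𝓞 E) (ζ - 1) * α ∈ w P := by
    convert h2 using 1
    rw [map_sub, map_one]; ring
  rcases hwp.mem_or_mem h3 with h4 | h4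
  · exact hζP (by rw [← hwP]; exact h4)
  · apply haP
    rw [← hwP, Ideal.mem_comap, ← hαp]
    exact Ideal.pow_mem_of_mem _ h4 _ hp.pos

theorem kummer_case (K : Type) [Field K] [NumberField K] (p : ℕ) (hp : p.Prime) (ζ : 𝓞 K)
    (hζ : IsPrimitiveRoot ζ p) (a : 𝓞 K) (ha0 : a ≠ 0)
    (hmod : ∀ P : Ideal (𝓞 K), P ≠ ⊥ → P.IsPrime → ∃ b, b ^ p - a ∈ P) :
    ∃ y : K, y ^ p = a := by
  by_contra hno
  push Not at hno
  have hirr : Irreducible (Polynomial.X ^ p - Polynomial.C (a : K)) :=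
    X_pow_sub_C_irreducible_of_prime hp hno
  let f : Polynomial K := Polynomial.X ^ p - Polynomial.C (a : K)
  have : Fact (Irreducible f) := ⟨hirr⟩
  let E := AdjoinRoot f
  have hmonic : f.Monic := Polynomial.monic_X_pow_sub_C _ hp.ne_zero
  have : Module.Finite K E := hmonic.finite_adjoinRoot
  have : NumberField E := NumberField.of_module_finite K E
  let r : E := AdjoinRoot.root f
  have hr : r ^ p = algebraMap K E a := by
    have := AdjoinRoot.eval₂_root f
    simp only [f, Polynomial.eval₂_sub, Polynomial.eval₂_pow, Polynomial.eval₂_X,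
      Polynomial.eval₂_C] at this
    exact sub_eq_zero.mp this
  have hrint : IsIntegral ℤ r := by
    apply IsIntegral.of_pow hp.pos
    rw [hr]
    exact (RingOfIntegers.isIntegral_coe a).map (IsScalarTower.toAlgHom ℤ K E)
  let τ : E →ₐ[K] E := AdjoinRoot.liftAlgHom f (Algebra.ofId K E) (algebraMap K E ζ * r) (by
    have hz : (algebraMap K E (ζ : K)) ^ p = 1 := by
      rw [← map_pow, ← map_pow, hζ.pow_eq_one, map_one, map_one]
    simp only [f, Polynomial.eval₂_sub, Polynomial.eval₂_pow, Polynomial.eval₂_X,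
      Polynomial.eval₂_C, mul_pow, hr, hz, one_mul]
    exact sub_self _)
  have hτ : τ r = algebraMap K E ζ * r := AdjoinRoot.liftAlgHom_root ..
  let α : 𝓞 E := ⟨r, hrint⟩
  let σ : 𝓞 E →ₐ[𝓞 K] 𝓞 E := RingOfIntegers.mapAlgHom τ
  refine kummer_no K E p hp ζ hζ a ha0 hmod α ?_ (AdjoinRoot.adjoinRoot_eq_top) σ ?_
  · apply RingOfIntegers.coe_injective
    exact hr
  · apply RingOfIntegers.coe_injective
    exact hτ

theorem pow_of_coprime {K : Type} [Field K] (p d : ℕ) (hpd : Nat.Coprime d p) (x y : K)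
    (hx : x ≠ 0) (h : x ^ d = y ^ p) : ∃ z : K, z ^ p = x := by
  have hb := Nat.gcd_eq_gcd_ab d p
  rw [hpd] at hb
  refine ⟨y ^ (Nat.gcdA d p) * x ^ (Nat.gcdB d p), ?_⟩
  have h1 : x = x ^ ((d : ℤ) * Nat.gcdA d p + p * Nat.gcdB d p) := by
    rw [← hb]; simp
  conv_rhs => rw [h1]
  rw [zpow_add₀ hx, zpow_mul, zpow_natCast, h, mul_pow, zpow_mul, zpow_natCast]
  congr 1
  · rw [← zpow_natCast, ← zpow_natCast, ← zpow_mul, ← zpow_mul, mul_comm]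
  · rw [← zpow_natCast, ← zpow_natCast, ← zpow_mul, ← zpow_mul, mul_comm]

theorem integral_case (K : Type) [Field K] [NumberField K] (p : ℕ) (hp : p.Prime)
    (a : 𝓞 K) (ha0 : a ≠ 0)
    (hmod : ∀ P : Ideal (𝓞 K), P ≠ ⊥ → P.IsPrime → ∃ b, b ^ p - a ∈ P) :
    ∃ y : K, y ^ p = a := by
  have : NeZero p := ⟨hp.ne_zero⟩
  have : NeZero (p : K) := ⟨Nat.cast_ne_zero.mpr hp.ne_zero⟩
  let L := CyclotomicField p K
  have : Module.Finite K L := IsCyclotomicExtension.finiteDimensional {p} K L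
  have : NumberField L := NumberField.of_module_finite K L
  have hz : IsPrimitiveRoot (IsCyclotomicExtension.zeta p K L) p :=
    IsCyclotomicExtension.zeta_spec p K L
  let ζ : 𝓞 L := hz.toInteger
  have hζ : IsPrimitiveRoot ζ p := hz.toInteger_isPrimitiveRoot
  have hinj : Function.Injective (algebraMap (𝓞 K) (𝓞 L)) := FaithfulSMul.algebraMap_injective _ _
  obtain ⟨y, hy⟩ := kummer_case L p hp ζ hζ (algebraMap (𝓞 K) (𝓞 L) a)
    (by rwa [Ne, map_eq_zero_iff _ hinj]) (by
      intro P hP0 hP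
      obtain ⟨b, hb⟩ := hmod (P.comap (algebraMap (𝓞 K) (𝓞 L)))
        (fun h ↦ hP0 (Ideal.eq_bot_of_comap_eq_bot h)) (Ideal.IsPrime.comap _)
      rw [Ideal.mem_comap, map_sub, map_pow] at hb
      exact ⟨_, hb⟩)
  have hy' : y ^ p = algebraMap K L a := hy
  have hN := congrArg (Algebra.norm K) hy'
  rw [map_pow, Algebra.norm_algebraMap] at hN
  refine pow_of_coprime p (Module.finrank K L) ?_ (a : K) (Algebra.norm K y)
    (by simpa using ha0) hN.symm
  have hle : Module.finrank K L ≤ p - 1 := by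
    have e := (hz.powerBasis K).finrank
    rw [e, IsPrimitiveRoot.powerBasis_dim]
    have h : Polynomial.aeval (IsCyclotomicExtension.zeta p K L) (Polynomial.cyclotomic p K) = 0 := by
      have h1 := hz.isRoot_cyclotomic hp.pos
      rw [Polynomial.IsRoot.def, ← Polynomial.map_cyclotomic p (algebraMap K L),
        ← Polynomial.eval₂_eq_eval_map, ← Polynomial.aeval_def] at h1
      exact h1
    have h2 := Polynomial.natDegree_le_of_dvd (minpoly.dvd K _ h) (Polynomial.cyclotomic_ne_zero p K)
    rwa [Polynomial.natDegree_cyclotomic, Nat.totient_prime hp] at h2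
  have hpos : 0 < Module.finrank K L := Module.finrank_pos
  rw [Nat.coprime_comm, hp.coprime_iff_not_dvd]
  intro hdvd
  have := Nat.le_of_dvd hpos hdvd
  have := hp.pos
  omega

theorem local_to_mod (K : Type) [Field K] [NumberField K] (p : ℕ) (hp : p.Prime) (a : 𝓞 K)
    (v : HeightOneSpectrum (𝓞 K)) (y : v.adicCompletion K)
    (hy : y ^ p = ((a : K) : v.adicCompletion K)) : ∃ b : 𝓞 K, b ^ p - a ∈ v.asIdeal := by
  have hva : Valued.v ((a : K) : v.adicCompletion K) ≤ 1 := by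
    rw [v.valuedAdicCompletion_eq_valuation']
    exact v.valuation_le_one a
  have hvy : Valued.v y ≤ 1 := by
    rw [← hy, map_pow] at hva
    exact (pow_le_one_iff hp.ne_zero).mp hva
  have hopen : IsOpen {z : v.adicCompletion K | Valued.v (z - y) < 1} := by
    have h := (Valued.isOpen_ball (v.adicCompletion K) 1).preimage
      (continuous_id.sub (continuous_const (y := y)))
    convert h using 1
    ext z
    simp [Valuation.restrict_lt_one_iff]
  obtain ⟨k, hk⟩ := (HeightOneSpectrum.denseRange_algebraMap K v).exists_mem_open hopen
    ⟨y, by simp⟩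
  have hk' : Valued.v ((k : v.adicCompletion K) - y) < 1 := hk
  have hvk : v.valuation K k ≤ 1 := by
    rw [← v.valuedAdicCompletion_eq_valuation']
    have := Valuation.map_add Valued.v ((k : v.adicCompletion K) - y) y
    rw [sub_add_cancel] at this
    exact this.trans (max_le hk'.le hvy)
  obtain ⟨b, hb⟩ := v.exists_valuation_sub_lt_of_integer hvk 1
  refine ⟨b, ?_⟩
  rw [← v.valuation_lt_one_iff_mem (K := K), ← v.valuedAdicCompletion_eq_valuation']
  have hb' : Valued.v (((b : K) : v.adicCompletion K) - y) < 1 := by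
    have h1 : Valued.v (((algebraMap (𝓞 K) K b - k : K)) : v.adicCompletion K) < 1 := by
      rw [v.valuedAdicCompletion_eq_valuation']; exact hb
    have h2 : ((b : K) : v.adicCompletion K) - y
      = ((algebraMap (𝓞 K) K b - k : K) : v.adicCompletion K) + ((k : v.adicCompletion K) - y) := by
      have : ((algebraMap (𝓞 K) K b - k : K) : v.adicCompletion K) = (b : K) - (k : v.adicCompletion K) :=
        map_sub (algebraMap K (v.adicCompletion K)) _ _
      rw [this]; ring
    rw [h2]
    exact (Valuation.map_add _ _ _).trans_lt (max_lt h1 hk')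
  have hvb : Valued.v ((b : K) : v.adicCompletion K) ≤ 1 := by
    rw [v.valuedAdicCompletion_eq_valuation']
    exact v.valuation_le_one b
  have h3 : ((algebraMap (𝓞 K) K (b ^ p - a) : K) : v.adicCompletion K)
      = ((b : K) : v.adicCompletion K) ^ p - y ^ p := by
    rw [hy, map_sub, map_pow]
    exact (map_sub (algebraMap K (v.adicCompletion K)) _ _).trans
      (by rw [map_pow]; rfl)
  rw [h3]
  obtain ⟨q, hq⟩ : ∃ q ∈ v.adicCompletionIntegers K, ((b : K) : v.adicCompletion K) ^ p - y ^ p =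
      (((b : K) : v.adicCompletion K) - y) * q := by
    refine ⟨∑ i ∈ Finset.range p, ((b : K) : v.adicCompletion K) ^ i * y ^ (p - 1 - i), ?_, ?_⟩
    · exact sum_mem fun i _ ↦ mul_mem (pow_mem hvb _) (pow_mem hvy _)
    · rw [mul_comm]; exact (Commute.all _ _).geom_sum₂_mul p |>.symm
  rw [hq.2, map_mul]
  exact mul_lt_one_of_lt_of_le hb' hq.1


end Helpers

/-- An element of a number field `K` that is a `p`-th power in every `v`-adic completion
of `K` (for `v` ranging over the maximal ideals of `𝒪_K`) is a `p`-th power in `K`. -/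
theorem local_pth_power_implies_global_pth_power
    (K : Type) [Field K] [NumberField K] (p : ℕ) (hp : p.Prime) (x : K) (hx : x ≠ 0)
    (hlocal : ∀ v : HeightOneSpectrum (𝓞 K),
      ∃ y : v.adicCompletion K, y ^ p = (x : v.adicCompletion K)) :
    ∃ y : K, y ^ p = x := by
  obtain ⟨n, d, hd, hnd⟩ := IsFractionRing.div_surjective (A := 𝓞 K) x
  have hd0 : (d : K) ≠ 0 := by simpa using nonZeroDivisors.ne_zero hd
  let a : 𝓞 K := n * d ^ (p - 1)
  have ha : (a : K) = x * d ^ p := by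
    have h1 : (d : K) ^ p = d ^ (p - 1) * d := by
      rw [← pow_succ, Nat.sub_add_cancel hp.one_le]
    rw [← hnd, h1]
    change algebraMap (𝓞 K) K (n * d ^ (p - 1)) = _
    rw [map_mul, map_pow]
    field_simp
  have ha0 : a ≠ 0 := by
    intro h
    rw [h] at ha
    exact mul_ne_zero hx (pow_ne_zero p hd0) (by rw [← ha]; simp)
  obtain ⟨y, hy⟩ := integral_case K p hp a ha0 (by
    intro P hP0 hP
    let v : HeightOneSpectrum (𝓞 K) := ⟨P, hP, hP0⟩
    obtain ⟨y, hy⟩ := hlocal v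
    refine local_to_mod K p hp a v (y * ((d : K) : v.adicCompletion K)) ?_
    rw [mul_pow, hy, ha]
    exact ((map_mul (algebraMap K (v.adicCompletion K)) _ _).trans (by rw [map_pow]; rfl)).symm)
  refine ⟨y / d, ?_⟩
  rw [div_pow, hy, ha]
  field_simp
end

section
/- Let p be a prime and let M/K be a Galois extension of number fields with [M : K] = p. Then there are infinitely many maximal ideals q of 𝒪_K that do not split completely in M; equivalently, there are infinitely many maximal ideals q of 𝒪_K such that exactly one maximal ideal of 𝒪_M lies over q. -/
open NumberField
open scoped ENNReal
open UniqueFactorizationMonoid Filter Topology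

/-- Zeta function over nonzero ideals divisible by no element of `T`. -/
noncomputable def partZeta (R : Type) [CommRing R] [IsDedekindDomain R] [Module.Free ℤ R]
    [Module.Finite ℤ R] (T : Set (Ideal R)) (s : ℝ) : ℝ≥0∞ :=
  ∑' I : {I : Ideal R // I ≠ ⊥ ∧ ∀ v ∈ T, ¬ v ∣ I}, (Ideal.absNorm I.1 : ℝ≥0∞) ^ (-s)

section
variable (R : Type) [CommRing R] [IsDedekindDomain R] [Module.Free ℤ R] [Module.Finite ℤ R]

lemma norm_weight_le_half [CharZero R] (v : Ideal R) (hv0 : v ≠ ⊥) (hv1 : v ≠ ⊤) {s : ℝ} (hs : 1 ≤ s) :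
    (Ideal.absNorm v : ℝ≥0∞) ^ (-s) ≤ 2⁻¹ := by
  have h2 : 2 ≤ Ideal.absNorm v := by
    have h0 : Ideal.absNorm v ≠ 0 := by rwa [Ne, Ideal.absNorm_eq_zero_iff]
    have h1 : Ideal.absNorm v ≠ 1 := by rwa [Ne, Ideal.absNorm_eq_one_iff]
    omega
  rw [ENNReal.rpow_neg]
  apply ENNReal.inv_le_inv.mpr
  calc (2 : ℝ≥0∞) ≤ (Ideal.absNorm v : ℝ≥0∞) := by exact_mod_cast h2
    _ = (Ideal.absNorm v : ℝ≥0∞) ^ (1:ℝ) := by simp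
    _ ≤ _ := ENNReal.rpow_le_rpow_of_exponent_le (by exact_mod_cast (by omega)) hs

lemma weight_mul (I J : Ideal R) (s : ℝ) :
    (Ideal.absNorm (I * J) : ℝ≥0∞) ^ (-s) =
      (Ideal.absNorm I : ℝ≥0∞) ^ (-s) * (Ideal.absNorm J : ℝ≥0∞) ^ (-s) := by
  rw [map_mul, Nat.cast_mul, ENNReal.mul_rpow_of_ne_top (by simp) (by simp)]

lemma partZeta_step [CharZero R] (T : Set (Ideal R)) (v : Ideal R) (hv0 : v ≠ ⊥) (hv1 : v ≠ ⊤)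
    {s : ℝ} (hs : 1 ≤ s) (hfin : partZeta R T s ≠ ∞) :
    partZeta R T s ≤ 2 * partZeta R (insert v T) s := by
  let X := {I : Ideal R // I ≠ ⊥ ∧ ∀ w ∈ T, ¬ w ∣ I}
  let f : X → ℝ≥0∞ := fun I => (Ideal.absNorm I.1 : ℝ≥0∞) ^ (-s)
  let A : Set X := {I | v ∣ I.1}
  have hsplit : ∑' x : A, f x + ∑' x : ↑(Aᶜ), f x = partZeta R T s :=
    Summable.tsum_add_tsum_compl ENNReal.summable ENNReal.summable
  have h1 : ∑' x : ↑(Aᶜ), f x ≤ partZeta R (insert v T) s := by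
    let g : ↑(Aᶜ) → {I : Ideal R // I ≠ ⊥ ∧ ∀ w ∈ insert v T, ¬ w ∣ I} := fun x =>
      ⟨x.1.1, x.1.2.1, by
        intro w hw
        rcases hw with rfl | hw
        · exact x.2
        · exact x.1.2.2 w hw⟩
    have hg : Function.Injective g := by
      intro x y h
      have := congrArg Subtype.val h
      exact Subtype.ext (Subtype.ext this)
    exact ENNReal.tsum_comp_le_tsum_of_injective hg
      (fun I => (Ideal.absNorm I.1 : ℝ≥0∞) ^ (-s))
  have h2 : ∑' x : A, f x ≤ 2⁻¹ * partZeta R T s := by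
    have hA : ∀ x : A, ∃ J : Ideal R, x.1.1 = v * J := fun x => x.2
    choose J hJ using hA
    let g : A → X := fun x => ⟨J x, by
      intro h0
      apply x.1.2.1
      rw [hJ, h0, Ideal.mul_bot], fun w hw hd => x.1.2.2 w hw (by
        rw [hJ]; exact hd.mul_left v)⟩
    have hg : Function.Injective g := by
      intro x y h
      have h : J x = J y := congrArg Subtype.val h
      exact Subtype.ext (Subtype.ext (by rw [hJ, hJ, h]))
    calc ∑' x : A, f x = ∑' x : A, (Ideal.absNorm v : ℝ≥0∞) ^ (-s) * f (g x) := by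
          congr 1; funext x
          change (Ideal.absNorm x.1.1 : ℝ≥0∞) ^ (-s) = _
          rw [hJ, weight_mul]
      _ = (Ideal.absNorm v : ℝ≥0∞) ^ (-s) * ∑' x : A, f (g x) := ENNReal.tsum_mul_left
      _ ≤ 2⁻¹ * partZeta R T s := by
          gcongr
          · exact norm_weight_le_half R v hv0 hv1 hs
          · exact ENNReal.tsum_comp_le_tsum_of_injective hg f
  clear_value f A
  generalize partZeta R T s = Z at *
  generalize partZeta R (insert v T) s = Z' at *
  have h3 : Z ≤ 2⁻¹ * Z + Z' := by
    exact hsplit.symm.le.trans (add_le_add h2 h1)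
  by_cases hZ' : Z' = ∞
  · simp [hZ']
  lift Z to NNReal using hfin
  lift Z' to NNReal using hZ'
  have : (2⁻¹ : ℝ≥0∞) = ((2⁻¹ : NNReal) : ℝ≥0∞) := by simp
  rw [this] at h3
  norm_cast at h3 ⊢
  have h4 : (Z : ℝ) ≤ 2⁻¹ * Z + Z' := by exact_mod_cast h3
  have : (Z : ℝ) ≤ 2 * Z' := by linarith
  exact_mod_cast this

lemma partZeta_le_empty (T : Set (Ideal R)) (s : ℝ) : partZeta R T s ≤ partZeta R ∅ s := by
  let g : {I : Ideal R // I ≠ ⊥ ∧ ∀ w ∈ T, ¬ w ∣ I} →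
      {I : Ideal R // I ≠ ⊥ ∧ ∀ w ∈ (∅ : Set (Ideal R)), ¬ w ∣ I} := fun x => ⟨x.1, x.2.1, by simp⟩
  have hg : Function.Injective g := by
    intro x y h
    have := congrArg Subtype.val h
    exact Subtype.ext this
  exact ENNReal.tsum_comp_le_tsum_of_injective hg
      (fun I => (Ideal.absNorm I.1 : ℝ≥0∞) ^ (-s))

lemma partZeta_finite [CharZero R] (T : Set (Ideal R)) (hT : T.Finite)
    (hp : ∀ v ∈ T, v ≠ ⊥ ∧ v ≠ ⊤)
    {s : ℝ} (hs : 1 ≤ s) (hfin : partZeta R ∅ s ≠ ∞) :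
    partZeta R ∅ s ≤ 2 ^ T.ncard * partZeta R T s := by
  induction T, hT using Set.Finite.induction_on with
  | empty => simp
  | @insert v T hv hT ih =>
    have ih' := ih (fun w hw => hp w (Set.mem_insert_of_mem _ hw))
    obtain ⟨h0, h1⟩ := hp v (Set.mem_insert _ _)
    refine ih'.trans ?_
    rw [Set.ncard_insert_of_notMem hv hT, pow_succ, mul_assoc]
    gcongr
    exact partZeta_step R T v h0 h1 hs (ne_top_of_le_ne_top hfin (partZeta_le_empty R T s))
end

/-- The injection argument. -/
lemma partZeta_sq_le (R S : Type) [CommRing R] [IsDedekindDomain R] [Module.Free ℤ R]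
    [Module.Finite ℤ R] [CommRing S] [IsDedekindDomain S] [Module.Free ℤ S]
    [Module.Finite ℤ S] [Algebra R S] (T : Set (Ideal R))
    (f₁ f₂ : Ideal R → Ideal S)
    (hp₁ : ∀ q, Prime q → q ∉ T → Prime (f₁ q)) (hp₂ : ∀ q, Prime q → q ∉ T → Prime (f₂ q))
    (hc₁ : ∀ q, Prime q → q ∉ T → (f₁ q).comap (algebraMap R S) = q)
    (hc₂ : ∀ q, Prime q → q ∉ T → (f₂ q).comap (algebraMap R S) = q)
    (hne : ∀ q, Prime q → q ∉ T → f₁ q ≠ f₂ q)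
    (hn₁ : ∀ q, Prime q → q ∉ T → Ideal.absNorm (f₁ q) = Ideal.absNorm q)
    (hn₂ : ∀ q, Prime q → q ∉ T → Ideal.absNorm (f₂ q) = Ideal.absNorm q) (s : ℝ) :
    partZeta R T s * partZeta R T s ≤ partZeta S ∅ s := by
  classical
  let X := {I : Ideal R // I ≠ ⊥ ∧ ∀ w ∈ T, ¬ w ∣ I}
  have hX : ∀ I : X, ∀ q ∈ normalizedFactors I.1, Prime q ∧ q ∉ T := fun I q hq =>
    ⟨prime_of_normalized_factor q hq, fun h => I.2.2 q h (dvd_of_mem_normalizedFactors hq)⟩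
  have key : ∀ (f : Ideal R → Ideal S), (∀ q, Prime q → q ∉ T → Prime (f q)) →
      (∀ q, Prime q → q ∉ T → Ideal.absNorm (f q) = Ideal.absNorm q) → ∀ I : X,
      (∀ Q ∈ (normalizedFactors I.1).map f, Prime Q) ∧
      ((normalizedFactors I.1).map f).prod ≠ ⊥ ∧
      Ideal.absNorm ((normalizedFactors I.1).map f).prod = Ideal.absNorm I.1 := by
    intro f hp hn I
    have h1 : ∀ Q ∈ (normalizedFactors I.1).map f, Prime Q := by
      intro Q hQ
      obtain ⟨q, hq, rfl⟩ := Multiset.mem_map.mp hQ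
      exact hp q (hX I q hq).1 (hX I q hq).2
    refine ⟨h1, ?_, ?_⟩
    · apply Multiset.prod_ne_zero
      intro h
      exact (h1 _ h).ne_zero rfl
    · conv_rhs => rw [← Ideal.prod_normalizedFactors_eq_self I.2.1]
      rw [map_multiset_prod, map_multiset_prod, Multiset.map_map]
      congr 1
      apply Multiset.map_congr rfl
      intro q hq
      exact hn q (hX I q hq).1 (hX I q hq).2
  have k₁ := key f₁ hp₁ hn₁
  have k₂ := key f₂ hp₂ hn₂
  let φ : X × X → {I : Ideal S // I ≠ ⊥ ∧ ∀ w ∈ (∅ : Set (Ideal S)), ¬ w ∣ I} := fun x =>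
    ⟨((normalizedFactors x.1.1).map f₁).prod * ((normalizedFactors x.2.1).map f₂).prod,
      mul_ne_zero (k₁ x.1).2.1 (k₂ x.2).2.1, by simp⟩
  have hnf : ∀ x, normalizedFactors (φ x).1 =
      (normalizedFactors x.1.1).map f₁ + (normalizedFactors x.2.1).map f₂ := by
    intro x
    change normalizedFactors (_ * _) = _
    rw [normalizedFactors_mul (k₁ x.1).2.1 (k₂ x.2).2.1,
      normalizedFactors_prod_of_prime (k₁ x.1).1, normalizedFactors_prod_of_prime (k₂ x.2).1]
  -- recover the factors by filtering
  let P : Ideal S → Prop := fun Q => f₁ (Q.comap (algebraMap R S)) = Q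
  have hP : ∀ x : X × X, (((normalizedFactors (φ x).1).filter P).map
      (Ideal.comap (algebraMap R S)) = normalizedFactors x.1.1) ∧
      (((normalizedFactors (φ x).1).filter (fun Q => ¬ P Q)).map
      (Ideal.comap (algebraMap R S)) = normalizedFactors x.2.1) := by
    intro x
    have a1 : ∀ Q ∈ (normalizedFactors x.1.1).map f₁, P Q := by
      intro Q hQ
      obtain ⟨q, hq, rfl⟩ := Multiset.mem_map.mp hQ
      change f₁ _ = _
      rw [hc₁ q (hX _ q hq).1 (hX _ q hq).2]
    have a2 : ∀ Q ∈ (normalizedFactors x.2.1).map f₂, ¬ P Q := by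
      intro Q hQ
      obtain ⟨q, hq, rfl⟩ := Multiset.mem_map.mp hQ
      change ¬ (f₁ _ = _)
      rw [hc₂ q (hX _ q hq).1 (hX _ q hq).2]
      exact hne q (hX _ q hq).1 (hX _ q hq).2
    rw [hnf, Multiset.filter_add, Multiset.filter_add, Multiset.filter_eq_self.mpr a1,
      Multiset.filter_eq_nil.mpr a2, Multiset.filter_eq_self.mpr a2,
      Multiset.filter_eq_nil.mpr (fun Q hQ => not_not.mpr (a1 Q hQ)), add_zero, zero_add,
      Multiset.map_map, Multiset.map_map]
    constructor
    · conv_rhs => rw [← Multiset.map_id (normalizedFactors x.1.1)]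
      apply Multiset.map_congr rfl
      intro q hq
      exact hc₁ q (hX _ q hq).1 (hX _ q hq).2
    · conv_rhs => rw [← Multiset.map_id (normalizedFactors x.2.1)]
      apply Multiset.map_congr rfl
      intro q hq
      exact hc₂ q (hX _ q hq).1 (hX _ q hq).2
  have hφ : Function.Injective φ := by
    intro x y h
    have b1 : normalizedFactors x.1.1 = normalizedFactors y.1.1 := by
      rw [← (hP x).1, ← (hP y).1, h]
    have b2 : normalizedFactors x.2.1 = normalizedFactors y.2.1 := by
      rw [← (hP x).2, ← (hP y).2, h]
    apply Prod.ext
    · apply Subtype.ext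
      rw [← Ideal.prod_normalizedFactors_eq_self x.1.2.1, b1,
        Ideal.prod_normalizedFactors_eq_self y.1.2.1]
    · apply Subtype.ext
      rw [← Ideal.prod_normalizedFactors_eq_self x.2.2.1, b2,
        Ideal.prod_normalizedFactors_eq_self y.2.2.1]
  calc partZeta R T s * partZeta R T s
      = ∑' x : X × X, (Ideal.absNorm x.1.1 : ℝ≥0∞) ^ (-s) * (Ideal.absNorm x.2.1 : ℝ≥0∞) ^ (-s) := by
        rw [ENNReal.tsum_prod (f := fun a b : X =>
          (Ideal.absNorm a.1 : ℝ≥0∞) ^ (-s) * (Ideal.absNorm b.1 : ℝ≥0∞) ^ (-s))]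
        simp_rw [ENNReal.tsum_mul_left, ENNReal.tsum_mul_right]
        rfl
    _ = ∑' x : X × X, (Ideal.absNorm (φ x).1 : ℝ≥0∞) ^ (-s) := by
        congr 1; funext x
        change _ = (Ideal.absNorm (_ * _) : ℝ≥0∞) ^ (-s)
        rw [weight_mul, (k₁ x.1).2.2, (k₂ x.2).2.2]
    _ ≤ _ := ENNReal.tsum_comp_le_tsum_of_injective hφ
        (fun I => (Ideal.absNorm I.1 : ℝ≥0∞) ^ (-s))

lemma partZeta_eq_tsum (K : Type) [Field K] [NumberField K] (s : ℝ) :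
    partZeta (𝓞 K) ∅ s = ∑' n : ℕ, ENNReal.ofReal (if n = 0 then 0 else
      (Nat.card {I : Ideal (𝓞 K) // Ideal.absNorm I = n} : ℝ) * (n : ℝ) ^ (-s)) := by
  let X := {I : Ideal (𝓞 K) // I ≠ ⊥ ∧ ∀ w ∈ (∅ : Set (Ideal (𝓞 K))), ¬ w ∣ I}
  rw [partZeta, ← ENNReal.tsum_fiberwise _ (fun I : X => Ideal.absNorm I.1)]
  congr 1
  funext n
  split_ifs with hn
  · subst hn
    rw [ENNReal.ofReal_zero, ENNReal.tsum_eq_zero]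
    rintro ⟨I, hI⟩
    exact absurd (Ideal.absNorm_eq_zero_iff.mp hI) I.2.1
  · have e : ↑((fun I : X => Ideal.absNorm I.1) ⁻¹' {n}) ≃
        {I : Ideal (𝓞 K) // Ideal.absNorm I = n} :=
      { toFun := fun I => ⟨I.1.1, I.2⟩
        invFun := fun I => ⟨⟨I.1, fun h => hn (by rw [← I.2, h, Ideal.absNorm_bot]), by simp⟩, I.2⟩
        left_inv := fun _ => rfl
        right_inv := fun _ => rfl }
    have hf : Finite {I : Ideal (𝓞 K) // Ideal.absNorm I = n} :=
      (Ideal.finite_setOfPred_absNorm_eq n).to_subtype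
    have : ∀ I : ↑((fun I : X => Ideal.absNorm I.1) ⁻¹' {n}),
        (Ideal.absNorm I.1.1 : ℝ≥0∞) ^ (-s) = (n : ℝ≥0∞) ^ (-s) := by
      intro I
      rw [show Ideal.absNorm I.1.1 = n from I.2]
    rw [tsum_congr this, ENNReal.tsum_const, ENat.card_congr e, ENat.card_eq_coe_natCard,
      ENNReal.ofReal_mul (by positivity), ← ENNReal.ofReal_rpow_of_pos (by positivity)]
    simp

lemma partZeta_dedekind (K : Type) [Field K] [NumberField K] (s : ℝ) (hs : 1 < s)
    (h0 : dedekindZeta K s ≠ 0) :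
    partZeta (𝓞 K) ∅ s ≠ ∞ ∧ dedekindZeta K s = ((partZeta (𝓞 K) ∅ s).toReal : ℂ) := by
  rw [partZeta_eq_tsum]
  set g : ℕ → ℝ := fun n => if n = 0 then 0 else
      (Nat.card {I : Ideal (𝓞 K) // Ideal.absNorm I = n} : ℝ) * (n : ℝ) ^ (-s) with hg
  have hg0 : ∀ n, 0 ≤ g n := by
    intro n; simp only [hg]; split_ifs <;> positivity
  have hterm : ∀ n, LSeries.term
      (fun n ↦ (Nat.card {I : Ideal (𝓞 K) // Ideal.absNorm I = n} : ℂ)) s n = (g n : ℂ) := by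
    intro n
    rw [LSeries.term_def]
    simp only [hg]
    split_ifs with hn
    · simp
    · rw [Complex.ofReal_mul, Complex.ofReal_cpow (by positivity), div_eq_mul_inv,
        ← Complex.cpow_neg]
      simp
  have hz : dedekindZeta K s = ∑' n, (g n : ℂ) := by
    rw [dedekindZeta, LSeries]
    exact tsum_congr hterm
  have hsum : Summable g := by
    rw [← Complex.summable_ofReal]
    by_contra h
    exact h0 (by rw [hz, tsum_eq_zero_of_not_summable h])
  rw [← ENNReal.ofReal_tsum_of_nonneg hg0 hsum]
  refine ⟨ENNReal.ofReal_ne_top, ?_⟩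
  rw [ENNReal.toReal_ofReal (tsum_nonneg hg0), hz, Complex.ofReal_tsum]

lemma partZeta_tendsto (K : Type) [Field K] [NumberField K] :
    (∀ᶠ s : ℝ in 𝓝[>] 1, partZeta (𝓞 K) ∅ s ≠ ∞) ∧
    Tendsto (fun s : ℝ => (s - 1) * (partZeta (𝓞 K) ∅ s).toReal) (𝓝[>] 1)
      (𝓝 (dedekindZeta_residue K)) := by
  have h := tendsto_sub_one_mul_dedekindZeta_nhdsGT K
  have hne : ∀ᶠ s : ℝ in 𝓝[>] 1, dedekindZeta K s ≠ 0 := by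
    have := h.eventually_ne (Complex.ofReal_ne_zero.mpr (dedekindZeta_residue_ne_zero K))
    filter_upwards [this] with s hs h0
    exact hs (by rw [h0, mul_zero])
  have hev : ∀ᶠ s : ℝ in 𝓝[>] 1, partZeta (𝓞 K) ∅ s ≠ ∞ ∧
      dedekindZeta K s = ((partZeta (𝓞 K) ∅ s).toReal : ℂ) := by
    filter_upwards [hne, self_mem_nhdsWithin] with s hs hs1
    exact partZeta_dedekind K s hs1 hs
  refine ⟨hev.mono fun s hs => hs.1, ?_⟩
  have h2 := (Complex.continuous_re.tendsto _).comp h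
  rw [Complex.ofReal_re] at h2
  refine h2.congr' ?_
  filter_upwards [hev] with s hs
  rw [Function.comp, hs.2, ← Complex.ofReal_one, ← Complex.ofReal_sub, ← Complex.ofReal_mul,
    Complex.ofReal_re]

/-- There is no norm preserving pair of sections outside a finite set of primes. -/
lemma no_double_section (K M : Type) [Field K] [NumberField K] [Field M] [NumberField M]
    (T : Set (Ideal (𝓞 K))) (hT : T.Finite) (hp : ∀ v ∈ T, v ≠ ⊥ ∧ v ≠ ⊤)
    (hsq : ∀ s : ℝ, partZeta (𝓞 K) T s * partZeta (𝓞 K) T s ≤ partZeta (𝓞 M) ∅ s) : False := by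
  obtain ⟨hK, hKt⟩ := partZeta_tendsto K
  obtain ⟨hM, hMt⟩ := partZeta_tendsto M
  set c : ℝ := 2 ^ T.ncard with hc
  have hineq : ∀ᶠ s : ℝ in 𝓝[>] 1, ((s - 1) * (partZeta (𝓞 K) ∅ s).toReal) ^ 2 ≤
      c ^ 2 * ((s - 1) * ((s - 1) * (partZeta (𝓞 M) ∅ s).toReal)) := by
    filter_upwards [hK, hM, self_mem_nhdsWithin] with s h1 h2 (h3 : 1 < s)
    have hT1 : partZeta (𝓞 K) T s ≠ ∞ := ne_top_of_le_ne_top h1 (partZeta_le_empty _ T s)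
    have a := ENNReal.toReal_mono (ENNReal.mul_ne_top (by simp) hT1)
      (partZeta_finite (𝓞 K) T hT hp h3.le h1)
    have b := ENNReal.toReal_mono h2 (hsq s)
    rw [ENNReal.toReal_mul, ENNReal.toReal_pow] at a
    rw [ENNReal.toReal_mul] at b
    change _ ≤ c * _ at a
    have z0 : 0 ≤ (partZeta (𝓞 K) ∅ s).toReal := ENNReal.toReal_nonneg
    have a2 := pow_le_pow_left₀ z0 a 2
    calc ((s - 1) * (partZeta (𝓞 K) ∅ s).toReal) ^ 2
        = (s - 1) ^ 2 * (partZeta (𝓞 K) ∅ s).toReal ^ 2 := by ring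
      _ ≤ (s - 1) ^ 2 * (c * (partZeta (𝓞 K) T s).toReal) ^ 2 := by gcongr
      _ = (s - 1) ^ 2 * c ^ 2 * ((partZeta (𝓞 K) T s).toReal * (partZeta (𝓞 K) T s).toReal) := by
          ring
      _ ≤ (s - 1) ^ 2 * c ^ 2 * (partZeta (𝓞 M) ∅ s).toReal := by gcongr
      _ = _ := by ring
  have hs0 : Tendsto (fun s : ℝ => s - 1) (𝓝[>] 1) (𝓝 0) := by
    have : Tendsto (fun s : ℝ => s - 1) (𝓝 1) (𝓝 (1 - 1)) :=
      (continuous_id.sub continuous_const).tendsto 1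
    rw [sub_self] at this
    exact this.mono_left nhdsWithin_le_nhds
  have hlim := le_of_tendsto_of_tendsto (hKt.pow 2) ((hs0.mul hMt).const_mul (c ^ 2)) hineq
  have := dedekindZeta_residue_pos K
  rw [zero_mul, mul_zero] at hlim
  have : 0 < dedekindZeta_residue K ^ 2 := by positivity
  linarith

theorem infinitely_many_nonsplit_primes_of_prime_degree_galois
    (p : ℕ) (hp : p.Prime) (K M : Type) [Field K] [NumberField K] [Field M] [NumberField M]
    [Algebra K M] [FiniteDimensional K M] [IsGalois K M]
    (hdeg : Module.finrank K M = p) :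
    {q : Ideal (𝓞 K) | q.IsMaximal ∧
      ∃! Q : Ideal (𝓞 M), Q.IsMaximal ∧ Q.comap (algebraMap (𝓞 K) (𝓞 M)) = q}.Infinite := by
  intro hT
  set T := {q : Ideal (𝓞 K) | q.IsMaximal ∧
      ∃! Q : Ideal (𝓞 M), Q.IsMaximal ∧ Q.comap (algebraMap (𝓞 K) (𝓞 M)) = q} with hTdef
  have hmain : ∀ q : Ideal (𝓞 K), ∃ Q₁ Q₂ : Ideal (𝓞 M), Prime q → q ∉ T →
      (Prime Q₁ ∧ Prime Q₂ ∧ Q₁.comap (algebraMap (𝓞 K) (𝓞 M)) = q ∧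
      Q₂.comap (algebraMap (𝓞 K) (𝓞 M)) = q ∧ Q₁ ≠ Q₂ ∧
      Ideal.absNorm Q₁ = Ideal.absNorm q ∧ Ideal.absNorm Q₂ = Ideal.absNorm q) := by
    intro q
    by_cases hq : Prime q ∧ q ∉ T
    swap
    · exact ⟨⊥, ⊥, fun h1 h2 => absurd ⟨h1, h2⟩ hq⟩
    obtain ⟨hq, hqT⟩ := hq
    have hq0 : q ≠ ⊥ := hq.ne_zero
    have hqp : q.IsPrime := Ideal.isPrime_of_prime hq
    have hqm : q.IsMaximal := hqp.isMaximal hq0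
    obtain ⟨Q₁, hQ₁m, hQ₁⟩ := Ideal.exists_maximal_ideal_liesOver_of_isIntegral (S := 𝓞 M) q
    have hQ₁c : Q₁.comap (algebraMap (𝓞 K) (𝓞 M)) = q := hQ₁.over.symm
    have : ∃ Q₂ : Ideal (𝓞 M), Q₂.IsMaximal ∧ Q₂.comap (algebraMap (𝓞 K) (𝓞 M)) = q ∧ Q₁ ≠ Q₂ := by
      by_contra! hcon
      exact hqT ⟨hqm, Q₁, ⟨hQ₁m, hQ₁c⟩, fun Q hQ => (hcon Q hQ.1 hQ.2).symm⟩
    obtain ⟨Q₂, hQ₂m, hQ₂c, hne⟩ := this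
    have hQ₂ : Q₂.LiesOver q := ⟨hQ₂c.symm⟩
    have hcard := Ideal.ncard_primesOver_mul_ramificationIdxIn_mul_inertiaDegIn q (𝓞 M) Gal(M/K)
    rw [IsGalois.card_aut_eq_finrank, hdeg] at hcard
    have hfin : (q.primesOver (𝓞 M)).Finite := Algebra.QuasiFinite.finite_primesOver q
    have hgt : 1 < (q.primesOver (𝓞 M)).ncard :=
      (Set.one_lt_ncard hfin).mpr ⟨Q₁, ⟨hQ₁m.isPrime, hQ₁⟩, Q₂, ⟨hQ₂m.isPrime, hQ₂⟩, hne⟩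
    have hdvd : (q.primesOver (𝓞 M)).ncard = p :=
      ((Nat.dvd_prime hp).mp ⟨_, hcard.symm⟩).resolve_left hgt.ne'
    have hef : q.ramificationIdxIn (𝓞 M) * q.inertiaDegIn (𝓞 M) = 1 := by
      rw [hdvd] at hcard
      exact Nat.eq_of_mul_eq_mul_left hp.pos (by rw [hcard, mul_one])
    have hf : q.inertiaDegIn (𝓞 M) = 1 := Nat.eq_one_of_mul_eq_one_left hef
    have hN : ∀ Q : Ideal (𝓞 M), Q.IsMaximal → Q.LiesOver q →
        Ideal.absNorm Q = Ideal.absNorm q ∧ Prime Q := by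
      intro Q hQm hQ
      constructor
      · rw [Ideal.absNorm_eq_pow_inertiaDeg'_of_liesOver Q q hqp hq0,
          Ideal.inertiaDeg'_eq_inertiaDeg, ← Ideal.inertiaDegIn_eq_inertiaDeg q Q Gal(M/K), hf,
          pow_one]
      · exact Ideal.prime_of_isPrime (Ideal.ne_bot_of_liesOver_of_ne_bot hq0 Q) hQm.isPrime
    exact ⟨Q₁, Q₂, fun _ _ => ⟨(hN Q₁ hQ₁m hQ₁).2, (hN Q₂ hQ₂m hQ₂).2, hQ₁c, hQ₂c, hne,
      (hN Q₁ hQ₁m hQ₁).1, (hN Q₂ hQ₂m hQ₂).1⟩⟩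
  choose f₁ f₂ hf using hmain
  refine no_double_section K M T hT (fun v hv => ⟨?_, hv.1.ne_top⟩) fun s =>
    partZeta_sq_le (𝓞 K) (𝓞 M) T f₁ f₂ (fun q h h' => (hf q h h').1) (fun q h h' => (hf q h h').2.1)
    (fun q h h' => (hf q h h').2.2.1) (fun q h h' => (hf q h h').2.2.2.1)
    (fun q h h' => (hf q h h').2.2.2.2.1) (fun q h h' => (hf q h h').2.2.2.2.2.1)
    (fun q h h' => (hf q h h').2.2.2.2.2.2) s
  exact Ring.ne_bot_of_isMaximal_of_not_isField hv.1 (RingOfIntegers.not_isField K)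
end

section
/- Let K ⊆ L be number fields with L/K a finite extension of odd degree. Then 𝒪_K^× ∩ (−4)·K^4 ≠ ∅ if and only if 𝒪_L^× ∩ (−4)·L^4 ≠ ∅; that is, there exist a ∈ K and a unit u of 𝒪_K with u = −4a⁴ if and only if there exist b ∈ L and a unit w of 𝒪_L with w = −4b⁴. -/
open NumberField

/-- For a finite extension `L/K` of number fields of odd degree, the unit group of `𝒪_K`
meets `-4·K⁴` if and only if the unit group of `𝒪_L` meets `-4·L⁴`. -/
theorem unit_neg_four_fourth_power_iff_of_odd_degree
    (K L : Type) [Field K] [NumberField K] [Field L] [NumberField L]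
    [Algebra K L] [FiniteDimensional K L] (hodd : Odd (Module.finrank K L)) :
    (∃ (a : K) (u : (𝓞 K)ˣ), ((u : 𝓞 K) : K) = -4 * a ^ 4) ↔
      (∃ (b : L) (w : (𝓞 L)ˣ), ((w : 𝓞 L) : L) = -4 * b ^ 4) := by
  constructor
  · rintro ⟨a, u, h⟩
    refine ⟨algebraMap K L a, Units.map (algebraMap (𝓞 K) (𝓞 L)).toMonoidHom u, ?_⟩
    have h2 : algebraMap K L ((u : 𝓞 K) : K) = -4 * (algebraMap K L a) ^ 4 := by
      rw [h, map_mul, map_pow, map_neg, map_ofNat]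
    rw [← h2]
    rfl
  · rintro ⟨b, w, h⟩
    obtain ⟨k, hk⟩ := hodd
    refine ⟨2 ^ k * Algebra.norm K b, Units.map (RingOfIntegers.norm K) w, ?_⟩
    have h1 : (((Units.map (RingOfIntegers.norm K) w : (𝓞 K)ˣ) : 𝓞 K) : K)
        = Algebra.norm K ((w : 𝓞 L) : L) := rfl
    have h2 : (-4 : L) = algebraMap K L (-4) := by rw [map_neg, map_ofNat]
    have h3 : (16 : K) ^ k = (2 ^ k) ^ 4 := by
      rw [← pow_mul, mul_comm, pow_mul]
      norm_num
    have h4 : (-4 : K) ^ (2 * k + 1) = -4 * (2 ^ k) ^ 4 := by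
      rw [pow_succ, pow_mul, ← h3]
      norm_num
      ring
    rw [h1, h, map_mul, map_pow, h2, Algebra.norm_algebraMap, hk, h4]
    ring
end

section
/- Let V be a two-dimensional vector space over 𝔽₂ and let g be an 𝔽₂-linear automorphism of V satisfying g³ = id and g ≠ id. Then the subspace of the tensor square V ⊗_{𝔽₂} V fixed by the automorphism g ⊗ g (the eigenspace of g ⊗ g for the eigenvalue 1) has 𝔽₂-dimension 2. -/
/-- If `g` is an order-dividing-3, nontrivial automorphism of a 2-dimensional `𝔽₂`-vector
space `V`, then the fixed subspace (the eigenspace for the eigenvalue `1`) of `g ⊗ g`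
acting on `V ⊗_{𝔽₂} V` has dimension `2`. -/
theorem finrank_fixed_subspace_tensor_sq_eq_two
    (V : Type) [AddCommGroup V] [Module (ZMod 2) V]
    (hdim : Module.finrank (ZMod 2) V = 2)
    (g : V ≃ₗ[ZMod 2] V) (hg3 : g ^ 3 = 1) (hg : g ≠ 1) :
    Module.finrank (ZMod 2)
      (Module.End.eigenspace
        (TensorProduct.map (g : V →ₗ[ZMod 2] V) (g : V →ₗ[ZMod 2] V)) 1) = 2 := by
  classical
  obtain ⟨v, hv⟩ : ∃ v, g v ≠ v := by
    by_contra! h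
    exact hg (LinearEquiv.ext h)
  have h3 : g (g (g v)) = v := by
    have := congrArg (fun f : V ≃ₗ[ZMod 2] V => f v) hg3
    simpa [pow_succ] using this
  have h01 : ∀ c : ZMod 2, c = 0 ∨ c = 1 := by decide
  have hv0 : v ≠ 0 := by
    rintro rfl
    simp at hv
  have hgv0 : g v ≠ 0 := by simpa using hv0
  have h2 : ∀ x : V, x + x = 0 := fun x => by
    rw [← two_smul (ZMod 2) x, show (2 : ZMod 2) = 0 from rfl, zero_smul]
  have hli : LinearIndependent (ZMod 2) ![v, g v] := by
    rw [LinearIndependent.pair_iff]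
    intro s t hst
    rcases h01 s with rfl | rfl <;> rcases h01 t with rfl | rfl
    · simp
    · simp [hv0] at hst
    · simp [hv0] at hst
    · exfalso
      simp only [one_smul] at hst
      apply hv
      calc g v = v + v + g v := by rw [h2]; simp
        _ = v := by rw [add_assoc, hst, add_zero]
  let b := basisOfLinearIndependentOfCardEqFinrank hli (by simp [hdim])
  have hb0 : b 0 = v := by simp [b]
  have hb1 : b 1 = g v := by simp [b]
  have hg0 : g (b 0) = b 1 := by rw [hb0, hb1]
  have hg1 : g (b 1) = b 0 + b 1 := by
    have e := b.sum_repr (g (b 1))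
    rw [Fin.sum_univ_two] at e
    generalize b.repr (g (b 1)) 0 = p at e
    generalize b.repr (g (b 1)) 1 = q at e
    have e3 : g (g (b 1)) = b 0 := by rw [hb0, hb1, h3]
    rcases h01 p with rfl | rfl <;> rcases h01 q with rfl | rfl <;>
      simp only [zero_smul, one_smul, zero_add, add_zero] at e
    · rw [← e] at e3
      exact absurd (e3.symm.trans (map_zero g)) (b.ne_zero 0)
    · rw [← e, ← e] at e3
      exact absurd (b.injective e3) (by decide)
    · rw [← e, hg0] at e3
      exact absurd (b.injective e3) (by decide)
    · exact e.symm
  clear_value b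
  let B := b.tensorProduct b
  have hB : ∀ i j, B (i, j) = b i ⊗ₜ[ZMod 2] b j := fun i j => by simp [B]
  set T := TensorProduct.map (g : V →ₗ[ZMod 2] V) (g : V →ₗ[ZMod 2] V) with hT
  have T00 : T (B (0, 0)) = B (1, 1) := by simp [hB, hT, hg0]
  have T01 : T (B (0, 1)) = B (1, 0) + B (1, 1) := by
    simp [hB, hT, hg0, hg1, TensorProduct.tmul_add]
  have T10 : T (B (1, 0)) = B (0, 1) + B (1, 1) := by
    simp [hB, hT, hg0, hg1, TensorProduct.add_tmul]
  have T11 : T (B (1, 1)) = B (0, 0) + B (0, 1) + (B (1, 0) + B (1, 1)) := by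
    simp only [hB, hT, TensorProduct.map_tmul, LinearEquiv.coe_coe, hg1, TensorProduct.add_tmul,
      TensorProduct.tmul_add]
    abel
  clear_value T B
  have htwo : ∀ x : TensorProduct (ZMod 2) V V, x + x = 0 := fun x => by
    rw [← two_smul (ZMod 2) x, show (2 : ZMod 2) = 0 from rfl, zero_smul]
  have hu : LinearIndependent (ZMod 2)
      ![B (0, 0) + B (0, 1) + B (1, 1), B (0, 1) + B (1, 0)] := by
    rw [LinearIndependent.pair_iff]
    intro s t hst
    have c1 := congrArg (fun x => B.repr x (0, 0)) hst
    have c2 := congrArg (fun x => B.repr x (1, 0)) hst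
    simp at c1 c2
    exact ⟨c1, c2⟩
  have hspan : Module.End.eigenspace T 1 = Submodule.span (ZMod 2)
      (Set.range ![B (0, 0) + B (0, 1) + B (1, 1), B (0, 1) + B (1, 0)]) := by
    apply le_antisymm
    · intro t ht
      rw [Module.End.mem_eigenspace_iff, one_smul] at ht
      have e := B.sum_repr t
      rw [Fintype.sum_prod_type] at e
      simp only [Fin.sum_univ_two] at e
      generalize B.repr t (0, 0) = x at e
      generalize B.repr t (0, 1) = y at e
      generalize B.repr t (1, 0) = z at e
      generalize B.repr t (1, 1) = w at e
      subst e
      simp only [map_add, map_smul, T00, T01, T10, T11] at ht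
      have c1 := congrArg (fun x => B.repr x (0, 0)) ht
      have c2 := congrArg (fun x => B.repr x (0, 1)) ht
      simp at c1 c2
      subst c1
      subst c2
      simp only [Matrix.range_cons, Matrix.range_empty, Set.union_empty, Set.singleton_union]
      rw [Submodule.mem_span_pair]
      exact ⟨w, z, by module⟩
    · rw [Submodule.span_le]
      rintro _ ⟨i, rfl⟩
      rw [SetLike.mem_coe, Module.End.mem_eigenspace_iff, one_smul]
      fin_cases i
      · simp only [Fin.zero_eta, Matrix.cons_val_zero, map_add, T00, T01, T11]
        have e1 := htwo (B (1, 1))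
        have e2 := htwo (B (1, 0))
        linear_combination (norm := module) e1 + e2
      · simp only [Fin.mk_one, Matrix.cons_val_one, Matrix.cons_val_zero, map_add, T01, T10]
        have e1 := htwo (B (1, 1))
        linear_combination (norm := module) e1
  rw [hspan, finrank_span_eq_card hu]
  simp
end

section
/- Let L be the splitting field over ℚ of the polynomial X³ + X² − 2X − 1 (so L = ℚ(ζ₇ + ζ₇⁻¹) is the maximal real subfield of the 7th cyclotomic field, a totally real cyclic cubic extension of ℚ). If u is a unit of 𝒪_L such that σ(u)·u⁻¹ is a square in the unit group 𝒪_L^× for every σ ∈ Gal(L/ℚ), then u is a square in 𝒪_L^× or −u is a square in 𝒪_L^×. Moreover, −1 is not a square in 𝒪_L^×; consequently, the subgroup of Gal(L/ℚ)-fixed classes in 𝒪_L^×/(𝒪_L^×)² is exactly the subgroup of order two generated by the class of −1. -/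
open NumberField Polynomial

lemma aux_natDegree : (X ^ 3 + X ^ 2 - 2 * X - 1 : ℚ[X]).natDegree = 3 := by
  have : (2 : ℚ[X]) = C 2 := rfl
  rw [this]; compute_degree!

lemma aux_monic : (X ^ 3 + X ^ 2 - 2 * X - 1 : ℚ[X]).Monic := by
  have : (2 : ℚ[X]) = C 2 := rfl
  rw [this]; monicity!

lemma aux_irred : Irreducible (X ^ 3 + X ^ 2 - 2 * X - 1 : ℚ[X]) := by
  rw [aux_monic.irreducible_iff_roots_eq_zero_of_degree_le_three
    (by rw [aux_natDegree]; norm_num) (by rw [aux_natDegree])]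
  rw [Multiset.eq_zero_iff_forall_notMem]
  intro r hr
  have hr' : r ^ 3 + r ^ 2 - 2 * r - 1 = 0 := by
    have := (mem_roots'.1 hr).2
    simpa [IsRoot] using this
  have hint : IsIntegral ℤ r := by
    refine ⟨X ^ 3 + X ^ 2 - C 2 * X - 1, by monicity!, ?_⟩
    simpa [eval₂_sub, eval₂_add, eval₂_mul] using hr'
  obtain ⟨n, rfl⟩ := IsIntegrallyClosed.isIntegral_iff.1 hint
  have h : n ^ 3 + n ^ 2 - 2 * n - 1 = 0 := by
    simp only [eq_intCast] at hr'
    exact_mod_cast hr'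
  have hd : n ∣ 1 := ⟨n ^ 2 + n - 2, by linarith⟩
  rcases Int.isUnit_iff.1 (isUnit_of_dvd_one hd) with rfl | rfl <;> norm_num at h

lemma aux_finrank (L : Type) [Field L] [Algebra ℚ L]
    [IsSplittingField ℚ L (X ^ 3 + X ^ 2 - 2 * X - 1)] : Module.finrank ℚ L = 3 := by
  have hs := IsSplittingField.splits L (X ^ 3 + X ^ 2 - 2 * X - 1 : ℚ[X])
  obtain ⟨a, ha⟩ := hs.exists_eval_eq_zero (by
    rw [degree_map, degree_eq_natDegree aux_monic.ne_zero, aux_natDegree]; norm_num)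
  have ha' : a ^ 3 + a ^ 2 - 2 * a - 1 = 0 := by simpa using ha
  have hm : minpoly ℚ a = X ^ 3 + X ^ 2 - 2 * X - 1 :=
    (minpoly.eq_of_irreducible_of_monic aux_irred (by simpa [aeval_def, eval₂_eq_eval_map] using ha') aux_monic).symm
  have hint : IsIntegral ℚ a := ⟨_, aux_monic, by simpa [eval₂_eq_eval_map] using ha'⟩
  have htop : IntermediateField.adjoin ℚ {a} = ⊤ := by
    have h1 := IsSplittingField.adjoin_rootSet L (X ^ 3 + X ^ 2 - 2 * X - 1 : ℚ[X])
    rw [← IntermediateField.toSubalgebra_inj, IntermediateField.top_toSubalgebra, eq_top_iff, ← h1]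
    refine Algebra.adjoin_le ?_
    intro b hb
    have hb' : b ^ 3 + b ^ 2 - 2 * b - 1 = 0 := by
      have := aeval_eq_zero_of_mem_rootSet hb
      simpa [aeval_def, eval₂_eq_eval_map] using this
    have haM : a ∈ IntermediateField.adjoin ℚ {a} := IntermediateField.mem_adjoin_simple_self ℚ a
    have hf : (b - a) * ((b - (a ^ 2 - 2)) * (b - (1 - a - a ^ 2))) = 0 := by
      linear_combination hb' + (a ^ 2 - a * b - 1) * ha'
    show b ∈ IntermediateField.adjoin ℚ {a}
    rcases mul_eq_zero.1 hf with h | h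
    · rw [sub_eq_zero.1 h]; exact haM
    rcases mul_eq_zero.1 h with h | h
    · rw [sub_eq_zero.1 h]
      exact sub_mem (pow_mem haM 2) (ofNat_mem _ 2)
    · rw [sub_eq_zero.1 h]
      exact sub_mem (sub_mem (one_mem _) haM) (pow_mem haM 2)
  rw [← IntermediateField.finrank_top', ← htop, IntermediateField.adjoin.finrank hint, hm,
    aux_natDegree]

/-- Let `L` be the splitting field over `ℚ` of `X³ + X² - 2X - 1` (the maximal real
subfield of the 7th cyclotomic field). If `u` is a unit of `𝒪_L` such that `σ(u)·u⁻¹` is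
a square in `𝒪_L^×` for every `σ ∈ Gal(L/ℚ)`, then `±u` is a square in `𝒪_L^×`.
Moreover, `-1` is not a square in `𝒪_L^×`; consequently the Galois-fixed classes in
`𝒪_L^×/(𝒪_L^×)²` form the order-two subgroup generated by the class of `-1`. -/
theorem galois_fixed_unit_classes_of_real_subfield_seventh_cyclotomic
    (L : Type) [Field L] [NumberField L] [Algebra ℚ L]
    [IsSplittingField ℚ L (X ^ 3 + X ^ 2 - 2 * X - 1)] :
    (∀ u : (𝓞 L)ˣ,
      (∀ σ : L ≃ₐ[ℚ] L, ∃ w : (𝓞 L)ˣ, σ ((u : 𝓞 L) : L) = ((u : 𝓞 L) : L) * (((w : 𝓞 L) : L)) ^ 2) →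
      ∃ w : (𝓞 L)ˣ, u = w ^ 2 ∨ u = -w ^ 2) ∧
    ¬ ∃ w : (𝓞 L)ˣ, w ^ 2 = -1 := by
  have h3 := aux_finrank L
  have : FiniteDimensional ℚ L := Module.finite_of_finrank_eq_succ h3
  have : IsGalois ℚ L := IsGalois.of_separable_splitting_field
    (p := X ^ 3 + X ^ 2 - 2 * X - 1) aux_irred.separable
  have hcard : Fintype.card (L ≃ₐ[ℚ] L) = 3 := by
    rw [← h3, ← Nat.card_eq_fintype_card]; exact IsGalois.card_aut_eq_finrank ℚ L
  constructor
  · intro u hu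
    choose w hw using hu
    have hn : Algebra.norm ℚ ((u : 𝓞 L) : L) = 1 ∨ Algebra.norm ℚ ((u : 𝓞 L) : L) = -1 := by
      have := NumberField.isUnit_iff_norm.1 u.isUnit
      rw [RingOfIntegers.coe_norm] at this
      have h2 := abs_eq (by norm_num) |>.1 this
      have e : ‹Algebra ℚ L› = DivisionRing.toRatAlgebra := Subsingleton.elim _ _
      rw [e]
      exact h2
    have hp := Algebra.norm_eq_prod_automorphisms ℚ ((u : 𝓞 L) : L)
    simp only [hw, Finset.prod_mul_distrib, Finset.prod_const, Finset.card_univ, hcard,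
      Finset.prod_pow] at hp
    set W : (𝓞 L)ˣ := ∏ σ, w σ with hW
    have hWL : ((W : 𝓞 L) : L) = ∏ σ, ((w σ : 𝓞 L) : L) := by
      rw [hW, Units.coe_prod]
      exact map_prod (algebraMap (𝓞 L) L) _ _
    rw [← hWL] at hp
    refine ⟨(u * W)⁻¹, ?_⟩
    rcases hn with h | h
    · left
      have key : u * (u * W) ^ 2 = 1 := by
        ext
        rw [h] at hp
        push_cast
        simp only [map_one] at hp
        linear_combination -hp
      rw [inv_pow]; exact eq_inv_of_mul_eq_one_left key
    · right
      have key : (-u) * (u * W) ^ 2 = 1 := by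
        ext
        rw [h] at hp
        push_cast
        simp only [map_one, map_neg] at hp
        linear_combination hp
      rw [inv_pow, ← eq_inv_of_mul_eq_one_left key, neg_neg]
  · rintro ⟨w, hw⟩
    have hL : ((w : 𝓞 L) : L) ^ 2 = algebraMap ℚ L (-1) := by
      have := congrArg (fun x : (𝓞 L)ˣ => ((x : 𝓞 L) : L)) hw
      simpa using this
    have := congrArg (Algebra.norm ℚ) hL
    rw [Algebra.norm_algebraMap, h3, map_pow] at this
    nlinarith [sq_nonneg (Algebra.norm ℚ ((w : 𝓞 L) : L))]
end
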